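/- Let a > 3/4. Define g_left(ω) := ∫_ℝ e^{−H_left,a(Z|ω)} dZ and g_right(ω) := ∫_ℝ e^{−H_right,a(ω|Z)} dZ for cycle configurations ω. Then g_left and g_right are finite everywhere and square integrable: ∫_{Ω_cycle} g_left(ω)² dω < ∞ and ∫_{Ω_cycle} g_right(ω)² dω < ∞, where dω is Lebesgue measure in the two real coordinates times counting measure on {−1,+1}×{A,B,C,D}; that is, g_left, g_right ∈ L²(Ω_cycle, dω). -/

import Mathlib

open MeasureTheory Real

/-- Tree labels A, B, C, D encoded as `Fin 4`. -/
abbrev TreeLabel := Fin 4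

def lA : TreeLabel := 0
def lB : TreeLabel := 1
def lC : TreeLabel := 2
def lD : TreeLabel := 3

/-- A cycle configuration `(X, X̄, σ, T)`; the sign `σ` is encoded as a `Bool`. -/
abbrev CycleConfig := ℝ × ℝ × Bool × TreeLabel

/-- The numerical value of a sign. -/
noncomputable def sgnv (b : Bool) : ℝ := if b then 1 else -1

/-- Real-valued indicator of a proposition. -/
noncomputable def indR (p : Prop) [Decidable p] : ℝ := if p then 1 else 0

/-- `U = (X + X̄)/2`. -/
noncomputable def Uof (ω : CycleConfig) : ℝ := (ω.1 + ω.2.1) / 2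

/-- `W = Γ + U' − U`. -/
noncomputable def Wof (ω : CycleConfig) (Γ : ℝ) (ω' : CycleConfig) : ℝ :=
  Γ + Uof ω' - Uof ω

noncomputable def Hln (a : ℝ) (ω : CycleConfig) (Z Γ : ℝ) (ω' : CycleConfig) : ℝ :=
  ((3 * a + 1) / 2) *
    (Real.log (exp (ω.1 + Wof ω Γ ω' / 2) + exp (ω'.1 - Wof ω Γ ω' / 2) + exp Z)
      + Real.log (exp (ω.2.1 + Wof ω Γ ω' / 2) + exp (ω'.2.1 - Wof ω Γ ω' / 2) + exp Z))

noncomputable def Hlinear (a : ℝ) (ω : CycleConfig) (Z : ℝ) (ω' : CycleConfig) : ℝ :=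
  -(a + 1 / 2) * (Uof ω + Uof ω' + Z)

noncomputable def Htree (ω : CycleConfig) (Z Γ : ℝ) (ω' : CycleConfig) : ℝ :=
  (1 / 2) * (indR (ω.2.2.2 = lC) * ω.1 + indR (ω.2.2.2 = lD) * ω.2.1
      + indR (ω'.2.2.2 = lC) * ω'.1 + indR (ω'.2.2.2 = lD) * ω'.2.1)
    + (indR (ω'.2.2.2 = lB) + indR (ω.2.2.2 = lA)) * Z
    + (1 / 2) * (indR (ω'.2.2.2 = lB) - indR (ω.2.2.2 = lA)) * Wof ω Γ ω'
    - (1 / 2) * (indR (ω.2.2.2 = lA) - indR (ω.2.2.2 = lB)) * Uof ω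
    + (1 / 2) * (indR (ω'.2.2.2 = lA) - indR (ω'.2.2.2 = lB)) * Uof ω'

noncomputable def HexpI (ω : CycleConfig) (ω' : CycleConfig) : ℝ :=
  (1 / 4) * (exp (-ω.1) + exp (-ω.2.1) + exp (-ω'.1) + exp (-ω'.2.1))

noncomputable def HexpII (ω : CycleConfig) (Z Γ : ℝ) (ω' : CycleConfig) : ℝ :=
  (1 / 2) * (sgnv ω.2.2.1 * exp (Wof ω Γ ω' / 4) - sgnv ω'.2.2.1 * exp (-Wof ω Γ ω' / 4)) ^ 2
    * exp (-Z)

/-- The (finite part of the) middle Hamiltonian `H_middle,a,η`. -/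
noncomputable def Hmid (a η : ℝ) (ω : CycleConfig) (Z Γ : ℝ) (ω' : CycleConfig) : ℝ :=
  Hln a ω Z Γ ω' + Hlinear a ω Z ω' + Htree ω Z Γ ω' + HexpI ω ω' + HexpII ω Z Γ ω' - η * Γ

/-- The left boundary Hamiltonian `H_left,a(Z|ω)`. -/
noncomputable def Hleft (a : ℝ) (Z : ℝ) (ω : CycleConfig) : ℝ :=
  a * Real.log (exp ω.2.1 + exp Z)
    + (a + 1 / 2) * (Real.log (exp ω.1 + exp Z) - Uof ω - Z)
    + (1 / 2) * (indR (ω.2.2.2 = lC) * ω.1 + indR (ω.2.2.2 = lD) * ω.2.1)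
    + indR (ω.2.2.2 = lB) * Z
    + (1 / 2) * (indR (ω.2.2.2 = lA) - indR (ω.2.2.2 = lB)) * Uof ω
    + (1 / 4) * (exp (-ω.1) + exp (-ω.2.1)) + (1 / 2) * exp (-Z)
    + Uof ω / 4

/-- The right boundary Hamiltonian `H_right,a(ω|Z)`. -/
noncomputable def Hright (a : ℝ) (ω : CycleConfig) (Z : ℝ) : ℝ :=
  (a + 1 / 2) * (Real.log (exp ω.1 + exp Z) + Real.log (exp ω.2.1 + exp Z) - Uof ω - Z)
    + (1 / 2) * (indR (ω.2.2.2 = lC) * ω.1 + indR (ω.2.2.2 = lD) * ω.2.1)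
    + indR (ω.2.2.2 = lA) * Z
    - (1 / 2) * (indR (ω.2.2.2 = lA) - indR (ω.2.2.2 = lB)) * Uof ω
    + (1 / 4) * (exp (-ω.1) + exp (-ω.2.1)) + (1 / 2) * exp (-Z)
    - Uof ω / 4

noncomputable instance : MeasureSpace Bool := ⟨Measure.count⟩
noncomputable instance : MeasureSpace TreeLabel := ⟨Measure.count⟩

/-- The constant `c₇(a) = (1/16)·min{a − 1/2, 1}`. -/
noncomputable def c7 (a : ℝ) : ℝ := (1 / 16) * min (a - 1 / 2) 1

/-- The constant `c₁₁(a) = (1/2)·min{a − 3/4, 1/6}`. -/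
noncomputable def c11 (a : ℝ) : ℝ := (1 / 2) * min (a - 3 / 4) (1 / 6)

/-- The constant `c₁₂(a) = min{c₇(a), c₁₁(a)}/2`. -/
noncomputable def c12 (a : ℝ) : ℝ := min (c7 a) (c11 a) / 2

/-- `‖(X, X̄, σ, T)‖ = c₁₂(a)·(|X| + |X̄|)`. -/
noncomputable def cycNorm (a : ℝ) (ω : CycleConfig) : ℝ := c12 a * (|ω.1| + |ω.2.1|)

/-- `‖(Z, Γ)‖ = c₁₂(a)·(|Z| + |Γ|)`. -/
noncomputable def rungNorm (a : ℝ) (Z Γ : ℝ) : ℝ := c12 a * (|Z| + |Γ|)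

/-- The Boltzmann weight `e^{−H_middle,a,η}`, with the convention `e^{−∞} = 0` when the
constraint `(T, TT) ≠ (A, B)` is violated. -/
noncomputable def wMid (a η : ℝ) (ω : CycleConfig) (Z Γ : ℝ) (ω' : CycleConfig) : ℝ :=
  if ω.2.2.2 = lA ∧ ω'.2.2.2 = lB then 0 else exp (-Hmid a η ω Z Γ ω')


lemma exp_lower (K : ℝ) (hK : 0 < K) :
    ∃ C : ℝ, 0 ≤ C ∧ ∀ x : ℝ, K * max (-x) 0 - C ≤ exp (-x) := by
  refine ⟨|K * log K|, abs_nonneg _, fun x => ?_⟩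
  have h1 : exp (-x) = K * exp (-x - log K) := by
    rw [exp_sub, exp_log hK]; field_simp
  have h2 := add_one_le_exp (-x - log K)
  have h3 := mul_le_mul_of_nonneg_left h2 hK.le
  have h4 := neg_abs_le (K * log K)
  have h5 := le_abs_self (K * log K)
  rcases le_total (-x) 0 with h | h
  · rw [max_eq_right h]
    have := exp_pos (-x)
    nlinarith
  · rw [max_eq_left h]
    nlinarith

lemma log_ge (x z : ℝ) : x ≤ log (exp x + exp z) ∧ z ≤ log (exp x + exp z) := by
  have hx := exp_pos x
  have hz := exp_pos z
  constructor
  · rw [le_log_iff_exp_le (by positivity)]; linarith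
  · rw [le_log_iff_exp_le (by positivity)]; linarith

lemma decomp (x : ℝ) : ∃ p n : ℝ, 0 ≤ p ∧ 0 ≤ n ∧ x = p - n ∧ |x| = p + n ∧ max (-x) 0 = n := by
  rcases le_total x 0 with h | h
  · exact ⟨0, -x, le_rfl, by linarith, by ring, by rw [abs_of_nonpos h]; ring,
      max_eq_left (by linarith)⟩
  · exact ⟨x, 0, h, le_rfl, by ring, by rw [abs_of_nonneg h]; ring, max_eq_right (by linarith)⟩

lemma label_cases (t : TreeLabel) : t = lA ∨ t = lB ∨ t = lC ∨ t = lD := by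
  revert t; decide

/-- common constant -/
noncomputable def cst (a : ℝ) : ℝ := min ((a - 3 / 4) / 4) (1 / 32)

lemma Hleft_lower (a : ℝ) (ha : 3 / 4 < a) :
    ∃ C : ℝ, ∀ (ω : CycleConfig) (Z : ℝ),
      cst a * (|ω.1| + |ω.2.1| + |Z|) - C ≤ Hleft a Z ω := by
  obtain ⟨C, hC, hexp⟩ := exp_lower (4 * (2 * a + 4)) (by linarith)
  refine ⟨3 * C, fun ω Z => ?_⟩
  obtain ⟨x, y, s, t⟩ := ω
  obtain ⟨hL1, hL2⟩ := log_ge y Z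
  obtain ⟨hM1, hM2⟩ := log_ge x Z
  have ex := hexp x
  have ey := hexp y
  have ez := hexp Z
  have hc1 : cst a ≤ (a - 3 / 4) / 4 := min_le_left _ _
  have hc2 : cst a ≤ 1 / 32 := min_le_right _ _
  simp only [Hleft, Uof]
  generalize log (exp y + exp Z) = L at *
  generalize log (exp x + exp Z) = M at *
  generalize exp (-x) = Ex at *
  generalize exp (-y) = Ey at *
  generalize exp (-Z) = Ez at *
  generalize cst a = c at *
  obtain ⟨p, n, hp, hn, hx, hax, hmx⟩ := decomp x
  obtain ⟨q, m, hq, hm, hy, hay, hmy⟩ := decomp y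
  obtain ⟨r, k, hr, hk, hz, haz, hmz⟩ := decomp Z
  rw [hmx] at ex
  rw [hmy] at ey
  rw [hmz] at ez
  rw [hax, hay, haz]
  clear hmx hmy hmz hax hay haz hexp
  obtain ⟨d, hd⟩ : ∃ d, d = a - 3 / 4 := ⟨_, rfl⟩
  have hd0 : 0 < d := by linarith
  have haa : a = d + 3 / 4 := by linarith
  clear hd
  subst haa hx hy hz
  have T : ∀ LL MM : ℝ, q ≤ LL → r ≤ LL → p ≤ MM → r ≤ MM →
    c * (p + q + r) ≤ (d + 3/4) * LL + (d + 3/4 + 1/2) * (MM - (p + q) / 2 - r) +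
      (1 / 2) * (indR (t = lC) * p + indR (t = lD) * q) + indR (t = lB) * r
      + (1 / 2) * (indR (t = lA) - indR (t = lB)) * ((p + q) / 2) + (p + q) / 2 / 4 := by
    intro LL MM h1 h2 h3 h4
    have s1 : 0 ≤ LL + MM - (p + q) / 2 - r := by linarith
    have hdp := mul_nonneg hd0.le hp
    have hdq := mul_nonneg hd0.le hq
    have hdr := mul_nonneg hd0.le hr
    have e1 := mul_le_mul_of_nonneg_left h1 hd0.le
    have e2 := mul_le_mul_of_nonneg_left h2 hd0.le
    have e3 := mul_le_mul_of_nonneg_left h3 hd0.le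
    have e4 := mul_le_mul_of_nonneg_left h4 hd0.le
    have f1 := mul_le_mul_of_nonneg_right hc1 hp
    have f2 := mul_le_mul_of_nonneg_right hc1 hq
    have f3 := mul_le_mul_of_nonneg_right hc1 hr
    have g1 := mul_le_mul_of_nonneg_right hc2 hp
    have g2 := mul_le_mul_of_nonneg_right hc2 hq
    have g3 := mul_le_mul_of_nonneg_right hc2 hr
    rcases label_cases t with h | h | h | h <;> subst h <;> simp [indR, lA, lB, lC, lD] <;> nlinarith
  have TT := T (L + (n + m + k)) (M + (n + m + k)) (by linarith) (by linarith) (by linarith) (by linarith)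
  have hdn := mul_nonneg hd0.le hn
  have hdm := mul_nonneg hd0.le hm
  have hdk := mul_nonneg hd0.le hk
  have g1 := mul_le_mul_of_nonneg_right hc2 hn
  have g2 := mul_le_mul_of_nonneg_right hc2 hm
  have g3 := mul_le_mul_of_nonneg_right hc2 hk
  clear T
  rcases label_cases t with h | h | h | h <;> subst h <;>
    simp [indR, lA, lB, lC, lD] at TT ⊢ <;> linarith

lemma Hright_lower (a : ℝ) (ha : 3 / 4 < a) :
    ∃ C : ℝ, ∀ (ω : CycleConfig) (Z : ℝ),
      cst a * (|ω.1| + |ω.2.1| + |Z|) - C ≤ Hright a ω Z := by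
  obtain ⟨C, hC, hexp⟩ := exp_lower (4 * (2 * a + 4)) (by linarith)
  refine ⟨3 * C, fun ω Z => ?_⟩
  obtain ⟨x, y, s, t⟩ := ω
  obtain ⟨hL1, hL2⟩ := log_ge y Z
  obtain ⟨hM1, hM2⟩ := log_ge x Z
  have ex := hexp x
  have ey := hexp y
  have ez := hexp Z
  have hc1 : cst a ≤ (a - 3 / 4) / 4 := min_le_left _ _
  have hc2 : cst a ≤ 1 / 32 := min_le_right _ _
  simp only [Hright, Uof]
  generalize log (exp y + exp Z) = L at *
  generalize log (exp x + exp Z) = M at *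
  generalize exp (-x) = Ex at *
  generalize exp (-y) = Ey at *
  generalize exp (-Z) = Ez at *
  generalize cst a = c at *
  obtain ⟨p, n, hp, hn, hx, hax, hmx⟩ := decomp x
  obtain ⟨q, m, hq, hm, hy, hay, hmy⟩ := decomp y
  obtain ⟨r, k, hr, hk, hz, haz, hmz⟩ := decomp Z
  rw [hmx] at ex
  rw [hmy] at ey
  rw [hmz] at ez
  rw [hax, hay, haz]
  clear hmx hmy hmz hax hay haz hexp
  obtain ⟨d, hd⟩ : ∃ d, d = a - 3 / 4 := ⟨_, rfl⟩
  have hd0 : 0 < d := by linarith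
  have haa : a = d + 3 / 4 := by linarith
  clear hd
  subst haa hx hy hz
  have T : ∀ LL MM : ℝ, q ≤ LL → r ≤ LL → p ≤ MM → r ≤ MM →
    c * (p + q + r) ≤ (d + 3/4 + 1/2) * (MM + LL - (p + q) / 2 - r) +
      (1 / 2) * (indR (t = lC) * p + indR (t = lD) * q) + indR (t = lA) * r
      - (1 / 2) * (indR (t = lA) - indR (t = lB)) * ((p + q) / 2) - (p + q) / 2 / 4 := by
    intro LL MM h1 h2 h3 h4
    have s1 : 0 ≤ LL + MM - (p + q) / 2 - r := by linarith
    have s2 := mul_nonneg hd0.le s1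
    have g1 := mul_le_mul_of_nonneg_right hc2 hp
    have g2 := mul_le_mul_of_nonneg_right hc2 hq
    have g3 := mul_le_mul_of_nonneg_right hc2 hr
    rcases label_cases t with h | h | h | h <;> subst h <;> simp [indR, lA, lB, lC, lD] <;> nlinarith
  have TT := T (L + (n + m + k)) (M + (n + m + k)) (by linarith) (by linarith) (by linarith) (by linarith)
  have hdn := mul_nonneg hd0.le hn
  have hdm := mul_nonneg hd0.le hm
  have hdk := mul_nonneg hd0.le hk
  have g1 := mul_le_mul_of_nonneg_right hc2 hn
  have g2 := mul_le_mul_of_nonneg_right hc2 hm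
  have g3 := mul_le_mul_of_nonneg_right hc2 hk
  clear T
  rcases label_cases t with h | h | h | h <;> subst h <;>
    simp [indR, lA, lB, lC, lD] at TT ⊢ <;> linarith

lemma cst_pos (a : ℝ) (ha : 3 / 4 < a) : 0 < cst a :=
  lt_min (by linarith) (by norm_num)

lemma measurable_indR (t : TreeLabel) :
    Measurable (fun q : CycleConfig × ℝ => indR (q.1.2.2.2 = t)) :=
  (measurable_of_finite (fun s : TreeLabel => indR (s = t))).comp
    (measurable_fst.snd.snd.snd)

lemma measurable_Hleft (a : ℝ) :
    Measurable (fun q : CycleConfig × ℝ => Hleft a q.2 q.1) := by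
  have hA := measurable_indR lA
  have hB := measurable_indR lB
  have hC := measurable_indR lC
  have hD := measurable_indR lD
  unfold Hleft Uof
  fun_prop

lemma measurable_Hright (a : ℝ) :
    Measurable (fun q : CycleConfig × ℝ => Hright a q.1 q.2) := by
  have hA := measurable_indR lA
  have hB := measurable_indR lB
  have hC := measurable_indR lC
  have hD := measurable_indR lD
  unfold Hright Uof
  fun_prop

lemma integrable_exp_abs (c : ℝ) (hc : 0 < c) : Integrable (fun x : ℝ => exp (-(c * |x|))) := by
  rw [← integrableOn_univ, ← Set.Iic_union_Ioi (a := (0 : ℝ))]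
  refine IntegrableOn.union ?_ ?_
  · refine (integrableOn_exp_mul_Iic hc 0).congr_fun (fun x hx => ?_) measurableSet_Iic
    simp only [abs_of_nonpos (Set.mem_Iic.1 hx)]
    congr 1; ring
  · refine (exp_neg_integrableOn_Ioi 0 hc).congr_fun (fun x hx => ?_) measurableSet_Ioi
    simp only [abs_of_pos (Set.mem_Ioi.1 hx)]
    congr 1; ring

lemma general (H : CycleConfig → ℝ → ℝ) (hm : Measurable (fun q : CycleConfig × ℝ => H q.1 q.2))
    (c C : ℝ) (hc : 0 < c)
    (hH : ∀ ω Z, c * (|ω.1| + |ω.2.1| + |Z|) - C ≤ H ω Z) :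
    (∀ ω : CycleConfig, Integrable (fun Z : ℝ => exp (-H ω Z))) ∧
    Integrable (fun ω : CycleConfig => (∫ Z : ℝ, exp (-H ω Z)) ^ 2) := by
  have hb : ∀ ω Z, exp (-H ω Z) ≤ exp C * exp (-(c * |ω.1|)) * exp (-(c * |ω.2.1|)) * exp (-(c * |Z|)) := by
    intro ω Z
    rw [← exp_add, ← exp_add, ← exp_add]
    apply exp_le_exp.2
    have := hH ω Z
    linarith
  have hI := integrable_exp_abs c hc
  have hint : ∀ ω : CycleConfig, Integrable (fun Z : ℝ => exp (-H ω Z)) := by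
    intro ω
    refine (hI.const_mul (exp C * exp (-(c * |ω.1|)) * exp (-(c * |ω.2.1|)))).mono' ?_ ?_
    · exact (measurable_exp.comp (hm.comp measurable_prodMk_left).neg).aestronglyMeasurable
    · refine Filter.Eventually.of_forall fun Z => ?_
      rw [norm_of_nonneg (exp_pos _).le]
      exact hb ω Z
  refine ⟨hint, ?_⟩
  have : IsFiniteMeasure (volume : Measure Bool) :=
    inferInstanceAs (IsFiniteMeasure (Measure.count : Measure Bool))
  have : IsFiniteMeasure (volume : Measure TreeLabel) :=
    inferInstanceAs (IsFiniteMeasure (Measure.count : Measure TreeLabel))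
  have hI2 := integrable_exp_abs (2 * c) (by linarith)
  have h1 : Integrable (fun _ : Bool × TreeLabel => (1 : ℝ)) := by
    have : IsFiniteMeasure ((volume : Measure Bool).prod (volume : Measure TreeLabel)) := inferInstance
    exact integrable_const (μ := (volume : Measure Bool).prod (volume : Measure TreeLabel)) 1
  have h2 : Integrable (fun ω : CycleConfig => exp (-(2 * c * |ω.1|)) * (exp (-(2 * c * |ω.2.1|)) * 1)) :=
    hI2.mul_prod (hI2.mul_prod h1)
  refine (h2.const_mul ((exp C * ∫ Z : ℝ, exp (-(c * |Z|))) ^ 2)).mono' ?_ ?_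
  · have hs : StronglyMeasurable (fun q : CycleConfig × ℝ => exp (-H q.1 q.2)) :=
      (measurable_exp.comp hm.neg).stronglyMeasurable
    exact (hs.integral_prod_right.pow 2).aestronglyMeasurable
  · refine Filter.Eventually.of_forall fun ω => ?_
    rw [norm_of_nonneg (sq_nonneg _)]
    have h3 : ∫ Z : ℝ, exp (-H ω Z) ≤
        exp C * exp (-(c * |ω.1|)) * exp (-(c * |ω.2.1|)) * ∫ Z : ℝ, exp (-(c * |Z|)) := by
      rw [← integral_const_mul]
      exact integral_mono (hint ω) (hI.const_mul _) (hb ω)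
    have h4 : 0 ≤ ∫ Z : ℝ, exp (-H ω Z) := integral_nonneg fun Z => (exp_pos _).le
    refine (pow_le_pow_left₀ h4 h3 2).trans (le_of_eq ?_)
    have e : ∀ x : ℝ, exp (-(2 * c * |x|)) = exp (-(c * |x|)) ^ 2 := by
      intro x; rw [← exp_nat_mul]; congr 1; push_cast; ring
    rw [e, e]; ring

/-- Lemma 4.7: for `a > 3/4`, `g_left(ω) = ∫ e^{−H_left,a(Z|ω)} dZ` and
`g_right(ω) = ∫ e^{−H_right,a(ω|Z)} dZ` are finite everywhere (the integrands are
integrable in `Z`) and square integrable over `Ω_cycle`. -/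
theorem boundary_functions_square_integrable (a : ℝ) (ha : 3 / 4 < a) :
    (∀ ω : CycleConfig, Integrable (fun Z : ℝ => exp (-Hleft a Z ω))) ∧
    Integrable (fun ω : CycleConfig => (∫ Z : ℝ, exp (-Hleft a Z ω)) ^ 2) ∧
    (∀ ω : CycleConfig, Integrable (fun Z : ℝ => exp (-Hright a ω Z))) ∧
    Integrable (fun ω : CycleConfig => (∫ Z : ℝ, exp (-Hright a ω Z)) ^ 2) := by
  obtain ⟨C₁, h1⟩ := Hleft_lower a ha
  obtain ⟨C₂, h2⟩ := Hright_lower a ha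
  have L := general (fun ω Z => Hleft a Z ω) (measurable_Hleft a) _ C₁ (cst_pos a ha) h1
  have R := general (fun ω Z => Hright a ω Z) (measurable_Hright a) _ C₂ (cst_pos a ha) h2
  exact ⟨L.1, L.2, R.1, R.2⟩
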